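/- The asymptotic outage probability satisfies P_o(γ̄) ~ [K((F̃(γ_th/γ̄))^{-θ} − 1) + 1]^{-1/θ} as γ̄ → ∞, where F̃(r) = r(1 − 2γ_E − log r); that is, the ratio of the exact OP (using F(r) = 1 − 2√r·K₁(2√r)) to this approximation tends to 1. -/

import Mathlib

open MeasureTheory ProbabilityTheory Real Set Filter Topology Asymptotics

/-- Modified Bessel function of the second kind of order 1, via the integral
representation `K₁(x) = ∫₀^∞ exp (-x * cosh t) * cosh t dt`. -/
noncomputable def besselK1 (x : ℝ) : ℝ :=
  ∫ t in Set.Ioi (0 : ℝ), Real.exp (-x * Real.cosh t) * Real.cosh t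

/-- The integrand of `1 - x * besselK1 x`, obtained by writing `1` as the integral of
`exp (-x * sinh t) * (x * cosh t)`. -/
noncomputable def besselDefect (x t : ℝ) : ℝ :=
  (Real.exp (-x * Real.sinh t) - Real.exp (-x * Real.cosh t)) * (x * Real.cosh t)

theorem exp_sinh_sub_exp_cosh (x t : ℝ) :
    Real.exp (-x * Real.sinh t) - Real.exp (-x * Real.cosh t) =
      Real.exp (-x * Real.sinh t) * (1 - Real.exp (-(x * Real.exp (-t)))) := by
  rw [mul_sub, mul_one, ← Real.exp_add, ← Real.cosh_sub_sinh]
  ring_nf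

theorem exp_neg_mul_cosh (t : ℝ) :
    Real.exp (-t) * Real.cosh t = (1 + Real.exp (-2 * t)) / 2 := by
  have h₁ : Real.exp (-t) * Real.exp t = 1 := by rw [← Real.exp_add]; simp
  have h₂ : Real.exp (-2 * t) = Real.exp (-t) * Real.exp (-t) := by
    rw [← Real.exp_add]; ring_nf
  rw [Real.cosh_eq, h₂]
  linear_combination h₁ / 2

theorem besselDefect_nonneg {x : ℝ} (hx : 0 ≤ x) (t : ℝ) : 0 ≤ besselDefect x t := by
  refine mul_nonneg (sub_nonneg.2 (Real.exp_le_exp.2 ?_)) (mul_nonneg hx (Real.cosh_pos t).le)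
  nlinarith [Real.sinh_lt_cosh t]

theorem le_besselDefect {x t : ℝ} (hx : 0 < x) (hx1 : x < 1) (ht : 0 ≤ t) :
    x ^ 2 / 2 * (1 - x) * (1 - x * Real.sinh t) ≤ besselDefect x t := by
  rcases le_total (1 - x * Real.sinh t) 0 with hneg | hpos
  · refine le_trans ?_ (besselDefect_nonneg hx.le t)
    exact mul_nonpos_of_nonneg_of_nonpos (mul_nonneg (by positivity) (by linarith)) hneg
  · have hy0 := Real.exp_pos (-t)
    have hy1 : Real.exp (-t) ≤ 1 := Real.exp_le_one_iff.2 (by linarith)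
    have hs : 1 - x * Real.sinh t ≤ Real.exp (-x * Real.sinh t) := by
      linarith [Real.add_one_le_exp (-x * Real.sinh t)]
    have hd : (1 - x) * (x * Real.exp (-t)) ≤ 1 - Real.exp (-(x * Real.exp (-t))) := by
      have hy : 0 < x * Real.exp (-t) := by positivity
      have hyx : x * Real.exp (-t) ≤ x := by nlinarith
      have h₁ : 1 + x * Real.exp (-t) ≤ Real.exp (x * Real.exp (-t)) := by
        linarith [Real.add_one_le_exp (x * Real.exp (-t))]
      have h₂ := Real.exp_pos (-(x * Real.exp (-t)))
      have h₃ : Real.exp (-(x * Real.exp (-t))) * Real.exp (x * Real.exp (-t)) = 1 := by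
        rw [← Real.exp_add]; simp
      have h₄ := mul_le_mul_of_nonneg_left h₁ h₂.le
      rw [h₃] at h₄
      have h₅ : 1 - x * Real.exp (-t) ≤ Real.exp (-(x * Real.exp (-t))) := by
        linarith [Real.add_one_le_exp (-(x * Real.exp (-t)))]
      nlinarith
    have hc : x ^ 2 / 2 ≤ x * Real.exp (-t) * (x * Real.cosh t) := by
      have h := exp_neg_mul_cosh t
      have h' := Real.exp_pos (-2 * t)
      calc x ^ 2 / 2 ≤ x ^ 2 * (Real.exp (-t) * Real.cosh t) := by rw [h]; nlinarith [sq_nonneg x]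
        _ = _ := by ring
    have hxc : 0 ≤ x * Real.cosh t := mul_nonneg hx.le (Real.cosh_pos t).le
    rw [besselDefect, exp_sinh_sub_exp_cosh]
    calc x ^ 2 / 2 * (1 - x) * (1 - x * Real.sinh t)
        ≤ x * Real.exp (-t) * (x * Real.cosh t) * (1 - x) * (1 - x * Real.sinh t) :=
          mul_le_mul_of_nonneg_right
            (mul_le_mul_of_nonneg_right hc (by linarith)) hpos
      _ = (1 - x * Real.sinh t) * ((1 - x) * (x * Real.exp (-t))) * (x * Real.cosh t) := by ring
      _ ≤ _ := mul_le_mul_of_nonneg_right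
          (mul_le_mul hs hd (mul_nonneg (by linarith) (by positivity)) (Real.exp_pos _).le) hxc

theorem besselDefect_le {x t : ℝ} (hx : 0 < x) (hx1 : x < 1) (ht : 0 ≤ t) :
    besselDefect x t ≤
      x ^ 2 / 2 * (Real.exp (-2 * t) + Real.exp (-t) / ((1 - x / 2) * Real.exp (-t) + x / 2)) := by
  have hsinh : 0 ≤ Real.sinh t := Real.sinh_nonneg_iff.2 ht
  have hE1 : Real.exp (-x * Real.sinh t) ≤ 1 := Real.exp_le_one_iff.2 (by nlinarith)
  have hd : 1 - Real.exp (-(x * Real.exp (-t))) ≤ x * Real.exp (-t) := by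
    linarith [Real.add_one_le_exp (-(x * Real.exp (-t)))]
  have he := Real.exp_pos (-t)
  have hden : 0 < (1 - x / 2) * Real.exp (-t) + x / 2 :=
    add_pos (mul_pos (by linarith) he) (by linarith)
  have hE : Real.exp (-x * Real.sinh t) ≤
      Real.exp (-t) / ((1 - x / 2) * Real.exp (-t) + x / 2) := by
    rw [le_div_iff₀ hden]
    have h₁ : Real.exp (-t) * Real.exp t = 1 := by rw [← Real.exp_add]; simp
    have h₂ : Real.exp (-t) ≤ 1 := Real.exp_le_one_iff.2 (by linarith)
    have h₃ : (1 - x / 2) * Real.exp (-t) + x / 2 ≤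
        Real.exp (-t) * Real.exp (x * Real.sinh t) := by
      have h₄ := mul_le_mul_of_nonneg_left (Real.add_one_le_exp (x * Real.sinh t)) he.le
      refine le_trans ?_ h₄
      rw [Real.sinh_eq]
      nlinarith [mul_nonneg he.le (sub_nonneg.2 h₂), mul_nonneg hx.le
        (mul_nonneg he.le (sub_nonneg.2 h₂))]
    have h₅ : Real.exp (-x * Real.sinh t) * Real.exp (x * Real.sinh t) = 1 := by
      rw [← Real.exp_add]; simp
    calc _ ≤ Real.exp (-x * Real.sinh t) * (Real.exp (-t) * Real.exp (x * Real.sinh t)) :=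
          mul_le_mul_of_nonneg_left h₃ (Real.exp_pos _).le
      _ = _ := by linear_combination Real.exp (-t) * h₅
  have h2 := Real.exp_pos (-2 * t)
  rw [besselDefect, exp_sinh_sub_exp_cosh]
  calc _ ≤ Real.exp (-x * Real.sinh t) * (x * Real.exp (-t)) * (x * Real.cosh t) :=
        mul_le_mul_of_nonneg_right (mul_le_mul_of_nonneg_left hd (Real.exp_pos _).le)
          (mul_nonneg hx.le (Real.cosh_pos t).le)
    _ = x ^ 2 / 2 * (Real.exp (-x * Real.sinh t) * (1 + Real.exp (-2 * t))) := by
        linear_combination x ^ 2 * Real.exp (-x * Real.sinh t) * exp_neg_mul_cosh t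
    _ ≤ _ := by
        refine mul_le_mul_of_nonneg_left ?_ (by positivity)
        nlinarith

theorem hasDerivAt_neg_log_div {x : ℝ} (hx : 0 < x) (hx1 : x < 1) (t : ℝ) :
    HasDerivAt (fun t => -(1 - x / 2)⁻¹ * Real.log ((1 - x / 2) * Real.exp (-t) + x / 2))
      (Real.exp (-t) / ((1 - x / 2) * Real.exp (-t) + x / 2)) t := by
  have ha : 0 < 1 - x / 2 := by linarith
  have hden : 0 < (1 - x / 2) * Real.exp (-t) + x / 2 := by positivity
  have h := ((((hasDerivAt_id t).neg.exp.const_mul (1 - x / 2)).add_const (x / 2)).log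
    hden.ne').const_mul (-(1 - x / 2)⁻¹)
  refine h.congr_deriv ?_
  have ha' : 2 - x ≠ 0 := by linarith
  simp only [id, Pi.neg_apply]
  field_simp

theorem tendsto_neg_log_div {x : ℝ} (hx : 0 < x) :
    Tendsto (fun t => -(1 - x / 2)⁻¹ * Real.log ((1 - x / 2) * Real.exp (-t) + x / 2)) atTop
      (𝓝 (-(1 - x / 2)⁻¹ * Real.log (x / 2))) := by
  have h : Tendsto (fun t => (1 - x / 2) * Real.exp (-t) + x / 2) atTop (𝓝 (x / 2)) := by
    simpa using (Real.tendsto_exp_neg_atTop_nhds_zero.const_mul (1 - x / 2)).add_const (x / 2)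
  exact (h.log (by positivity)).const_mul _

theorem integrableOn_besselDefect_bound {x : ℝ} (hx : 0 < x) (hx1 : x < 1) :
    IntegrableOn (fun t => Real.exp (-t) / ((1 - x / 2) * Real.exp (-t) + x / 2)) (Ioi 0) := by
  refine integrableOn_Ioi_deriv_of_nonneg' (fun t _ => hasDerivAt_neg_log_div hx hx1 t)
    (fun t _ => ?_) (tendsto_neg_log_div hx)
  have ha : 0 < 1 - x / 2 := by linarith
  positivity

theorem integrableOn_besselDefect {x : ℝ} (hx : 0 < x) (hx1 : x < 1) :
    IntegrableOn (besselDefect x) (Ioi 0) := by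
  refine Integrable.mono' (((exp_neg_integrableOn_Ioi 0 two_pos).add
    (integrableOn_besselDefect_bound hx hx1)).const_mul (x ^ 2 / 2)) ?_ ?_
  · refine Continuous.aestronglyMeasurable ?_
    unfold besselDefect
    fun_prop
  · refine (ae_restrict_iff' measurableSet_Ioi).2 (Eventually.of_forall fun t ht => ?_)
    rw [Real.norm_of_nonneg (besselDefect_nonneg hx.le t)]
    exact besselDefect_le hx hx1 (le_of_lt ht)

theorem one_sub_mul_besselK1 {x : ℝ} (hx : 0 < x) (hx1 : x < 1) :
    1 - x * besselK1 x = ∫ t in Ioi (0 : ℝ), besselDefect x t := by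
  have hderiv : ∀ t ∈ Ici (0 : ℝ), HasDerivAt (fun t => -Real.exp (-x * Real.sinh t))
      (Real.exp (-x * Real.sinh t) * (x * Real.cosh t)) t := fun t _ => by
    refine ((Real.hasDerivAt_sinh t).const_mul (-x)).exp.neg.congr_deriv ?_
    ring
  have hpos : ∀ t ∈ Ioi (0 : ℝ), 0 ≤ Real.exp (-x * Real.sinh t) * (x * Real.cosh t) :=
    fun t _ => mul_nonneg (Real.exp_pos _).le (mul_nonneg hx.le (Real.cosh_pos t).le)
  have hlim : Tendsto (fun t => -Real.exp (-x * Real.sinh t)) atTop (𝓝 0) := by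
    have hs : Tendsto Real.sinh atTop atTop :=
      tendsto_atTop_mono' _ ((eventually_ge_atTop 0).mono fun t ht => Real.self_le_sinh_iff.2 ht)
        tendsto_id
    have := (Real.tendsto_exp_atBot.comp (hs.const_mul_atTop_of_neg (neg_lt_zero.2 hx))).neg
    simpa using this
  have hint := integrableOn_Ioi_deriv_of_nonneg' hderiv hpos hlim
  have hone := integral_Ioi_of_hasDerivAt_of_nonneg' hderiv hpos hlim
  have hsplit : ∀ t, x * (Real.exp (-x * Real.cosh t) * Real.cosh t) =
      Real.exp (-x * Real.sinh t) * (x * Real.cosh t) - besselDefect x t := fun t => by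
    rw [besselDefect]; ring
  rw [besselK1, ← integral_const_mul]
  simp_rw [hsplit]
  rw [integral_sub hint (integrableOn_besselDefect hx hx1), hone]
  simp

theorem one_sub_mul_besselK1_le {x : ℝ} (hx : 0 < x) (hx1 : x < 1) :
    1 - x * besselK1 x ≤ x ^ 2 / 2 * (1 / 2 + (1 - x / 2)⁻¹ * -Real.log (x / 2)) := by
  have ha : 0 < 1 - x / 2 := by linarith
  have hexp : ∫ t in Ioi (0 : ℝ), Real.exp (-2 * t) = 1 / 2 := by
    rw [integral_exp_mul_Ioi (by norm_num)]; simp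
  have hlog : ∫ t in Ioi (0 : ℝ), Real.exp (-t) / ((1 - x / 2) * Real.exp (-t) + x / 2) =
      (1 - x / 2)⁻¹ * -Real.log (x / 2) := by
    rw [integral_Ioi_of_hasDerivAt_of_tendsto' (fun t _ => hasDerivAt_neg_log_div hx hx1 t)
      (integrableOn_besselDefect_bound hx hx1) (tendsto_neg_log_div hx)]
    simp
  have hi := exp_neg_integrableOn_Ioi 0 two_pos
  have hb := integrableOn_besselDefect_bound hx hx1
  rw [one_sub_mul_besselK1 hx hx1, ← hexp, ← hlog, ← integral_add hi hb, ← integral_const_mul]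
  exact setIntegral_mono_on (integrableOn_besselDefect hx hx1) ((hi.add hb).const_mul _)
    measurableSet_Ioi fun t ht => besselDefect_le hx hx1 (le_of_lt ht)

theorem le_one_sub_mul_besselK1 {x : ℝ} (hx : 0 < x) (hx1 : x < 1) :
    x ^ 2 / 2 * (1 - x) * (-Real.log x - 1) ≤ 1 - x * besselK1 x := by
  have hT : 0 ≤ -Real.log x := neg_nonneg.2 (Real.log_nonpos hx.le hx1.le)
  have hval : ∫ t in (0 : ℝ)..(-Real.log x), (1 - x * Real.sinh t) =
      -Real.log x - x * (Real.cosh (-Real.log x) - 1) := by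
    rw [intervalIntegral.integral_eq_sub_of_hasDerivAt (f := fun t => t - x * Real.cosh t)
      (fun t _ => (hasDerivAt_id t).sub ((Real.hasDerivAt_cosh t).const_mul x))
      (Continuous.intervalIntegrable (by fun_prop) _ _)]
    simp
    ring
  have hcosh : x * (Real.cosh (-Real.log x) - 1) ≤ 1 := by
    rw [Real.cosh_neg, Real.cosh_log hx]
    have : x * x⁻¹ = 1 := mul_inv_cancel₀ hx.ne'
    nlinarith
  rw [one_sub_mul_besselK1 hx hx1]
  have hcont : Continuous fun t => x ^ 2 / 2 * (1 - x) * (1 - x * Real.sinh t) := by fun_prop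
  have hi := integrableOn_besselDefect hx hx1
  have hsub : Ioc 0 (-Real.log x) ⊆ Ioi (0 : ℝ) := fun t ht => ht.1
  calc x ^ 2 / 2 * (1 - x) * (-Real.log x - 1)
      ≤ x ^ 2 / 2 * (1 - x) * ∫ t in (0 : ℝ)..(-Real.log x), (1 - x * Real.sinh t) := by
        rw [hval]
        exact mul_le_mul_of_nonneg_left (by linarith)
          (mul_nonneg (by positivity) (by linarith))
    _ = ∫ t in Ioc 0 (-Real.log x), x ^ 2 / 2 * (1 - x) * (1 - x * Real.sinh t) := by
        rw [← intervalIntegral.integral_const_mul, intervalIntegral.integral_of_le hT]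
    _ ≤ ∫ t in Ioc 0 (-Real.log x), besselDefect x t :=
        setIntegral_mono_on (hcont.integrableOn_Ioc) (hi.mono_set hsub) measurableSet_Ioc
          fun t ht => le_besselDefect hx hx1 ht.1.le
    _ ≤ ∫ t in Ioi (0 : ℝ), besselDefect x t :=
        setIntegral_mono_set hi (Eventually.of_forall fun t => besselDefect_nonneg hx.le t)
          hsub.eventuallyLE

theorem tendsto_neg_log_nhdsGT_zero : Tendsto (fun r => -Real.log r) (𝓝[>] 0) atTop :=
  tendsto_neg_atBot_atTop.comp Real.tendsto_log_nhdsGT_zero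

theorem tendsto_const_div_neg_log (c : ℝ) :
    Tendsto (fun r => c / -Real.log r) (𝓝[>] 0) (𝓝 0) :=
  tendsto_neg_log_nhdsGT_zero.const_div_atTop c

theorem isEquivalent_one_sub_besselK1 :
    (fun r : ℝ => 1 - 2 * Real.sqrt r * besselK1 (2 * Real.sqrt r)) ~[𝓝[>] 0]
      fun r => r * -Real.log r := by
  refine isEquivalent_of_tendsto_one ?_
  have hsqrt : Tendsto Real.sqrt (𝓝[>] 0) (𝓝 0) := by
    simpa using (Real.continuous_sqrt.tendsto 0).mono_left nhdsWithin_le_nhds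
  have hlow : Tendsto (fun r => (1 - 2 * Real.sqrt r) *
      (1 - (2 + Real.log 4) / -Real.log r)) (𝓝[>] 0) (𝓝 1) := by
    simpa using ((hsqrt.const_mul 2).const_sub 1).mul
      ((tendsto_const_div_neg_log (2 + Real.log 4)).const_sub 1)
  have hupp : Tendsto (fun r => 1 / -Real.log r + (1 - Real.sqrt r)⁻¹) (𝓝[>] 0) (𝓝 1) := by
    have h := (hsqrt.const_sub 1).inv₀ (by norm_num)
    simpa using (tendsto_const_div_neg_log 1).add h
  have hsmall : ∀ᶠ r : ℝ in 𝓝[>] 0, 0 < r ∧ 2 * Real.sqrt r < 1 ∧ 0 < -Real.log r := by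
    refine Eventually.and self_mem_nhdsWithin (Eventually.and ?_
      (tendsto_neg_log_nhdsGT_zero.eventually_gt_atTop 0))
    have h : Tendsto (fun r => 2 * Real.sqrt r) (𝓝[>] 0) (𝓝 0) := by
      simpa using hsqrt.const_mul 2
    exact h.eventually_lt_const one_pos
  refine tendsto_of_tendsto_of_tendsto_of_le_of_le' hlow hupp ?_ ?_
  · filter_upwards [hsmall] with r ⟨hr, hs, hL⟩
    have hlog : Real.log (2 * Real.sqrt r) = (Real.log 4 + Real.log r) / 2 := by
      rw [Real.log_mul two_ne_zero (Real.sqrt_pos.2 hr).ne', Real.log_sqrt hr.le,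
        show (4 : ℝ) = 2 ^ 2 by norm_num, Real.log_pow]
      push_cast
      ring
    have h := le_one_sub_mul_besselK1 (mul_pos two_pos (Real.sqrt_pos.2 hr)) hs
    rw [Pi.div_apply, le_div_iff₀ (mul_pos hr hL)]
    refine le_trans (le_of_eq ?_) h
    rw [hlog, mul_pow, Real.sq_sqrt hr.le]
    have hL' : Real.log r ≠ 0 := by linarith
    field_simp
    ring
  · filter_upwards [hsmall] with r ⟨hr, hs, hL⟩
    have h := one_sub_mul_besselK1_le (mul_pos two_pos (Real.sqrt_pos.2 hr)) hs
    rw [Pi.div_apply, div_le_iff₀ (mul_pos hr hL)]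
    refine h.trans (le_of_eq ?_)
    rw [mul_div_cancel_left₀ _ two_ne_zero, mul_pow, Real.sq_sqrt hr.le, Real.log_sqrt hr.le]
    have hL' : Real.log r ≠ 0 := by linarith
    have hs' : 1 - Real.sqrt r ≠ 0 := by linarith [Real.sqrt_nonneg r]
    field_simp
    ring

theorem isEquivalent_mul_const_sub_log (c : ℝ) :
    (fun r : ℝ => r * (c - Real.log r)) ~[𝓝[>] 0] fun r => r * -Real.log r := by
  refine IsEquivalent.refl.mul ?_
  have h := IsEquivalent.const_add_of_norm_tendsto_atTop (c := c)
    (IsEquivalent.refl (u := fun r : ℝ => -Real.log r) (l := 𝓝[>] 0))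
    (tendsto_norm_atTop_atTop.comp tendsto_neg_log_nhdsGT_zero)
  simpa only [sub_eq_add_neg] using h

theorem Asymptotics.IsEquivalent.rpow_of_eventually_pos {α : Type*} {l : Filter α}
    {u v : α → ℝ} (h : u ~[l] v) (hv : ∀ᶠ a in l, 0 < v a) (s : ℝ) :
    (fun a => u a ^ s) ~[l] fun a => v a ^ s := by
  have hlim := (isEquivalent_iff_tendsto_one (hv.mono fun _ => ne_of_gt)).1 h
  refine isEquivalent_of_tendsto_one ?_
  have hpow := hlim.rpow_const (p := s) (Or.inl one_ne_zero)
  rw [Real.one_rpow] at hpow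
  refine hpow.congr' ?_
  filter_upwards [hv, hlim.eventually_const_lt one_pos] with a hva hua
  have : 0 < u a := by
    have := mul_pos hua hva
    rwa [Pi.div_apply, div_mul_cancel₀ _ hva.ne'] at this
  exact Real.div_rpow this.le hva.le s

theorem isEquivalent_const_mul_rpow_neg_sub_one_add_one {α : Type*} {l : Filter α}
    {u v : α → ℝ} (h : u ~[l] v) (hv : Tendsto v l (𝓝[>] 0)) {k θ : ℝ} (hk : 0 < k)
    (hθ : 0 < θ) (s : ℝ) :
    (fun a => (k * (u a ^ (-θ) - 1) + 1) ^ s) ~[l] fun a => (k * (v a ^ (-θ))) ^ s := by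
  have hpos : ∀ᶠ a in l, 0 < v a := hv.eventually self_mem_nhdsWithin
  have htop : Tendsto (fun a => k * v a ^ (-θ)) l atTop :=
    ((tendsto_rpow_neg_nhdsGT_zero (neg_lt_zero.2 hθ)).comp hv).const_mul_atTop hk
  have hpow := (IsEquivalent.refl (u := fun _ => k) (l := l)).mul
    (h.rpow_of_eventually_pos hpos (-θ))
  have hconst := IsEquivalent.const_add_of_norm_tendsto_atTop (c := 1 - k) hpow
    (tendsto_norm_atTop_atTop.comp htop)
  refine IsEquivalent.rpow_of_eventually_pos ?_ (htop.eventually_gt_atTop 0) s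
  refine hconst.congr_left (Eventually.of_forall fun a => ?_)
  simp only [Pi.mul_apply]
  ring

/-- The exact outage probability is asymptotically equivalent, as `γ̄ → ∞`, to the
approximation obtained by replacing `F(r) = 1 − 2√r·K₁(2√r)` with its small-argument
expansion `F̃(r) = r(1 − 2γ_E − log r)`. -/
theorem outage_probability_asymptotic (K : ℕ) (hK : 1 ≤ K)
    (θ γth : ℝ) (hθ : 0 < θ) (hγth : 0 < γth) :
    Tendsto (fun γbar : ℝ =>
      (((K : ℝ) * ((1 - 2 * Real.sqrt (γth / γbar) *
            besselK1 (2 * Real.sqrt (γth / γbar))) ^ (-θ) - 1) + 1) ^ (-1 / θ)) /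
      (((K : ℝ) * (((γth / γbar) *
            (1 - 2 * Real.eulerMascheroniConstant - Real.log (γth / γbar))) ^ (-θ)
            - 1) + 1) ^ (-1 / θ)))
      atTop (𝓝 1) := by
  have hr : Tendsto (fun γbar : ℝ => γth / γbar) atTop (𝓝[>] 0) :=
    tendsto_nhdsWithin_iff.2 ⟨tendsto_id.const_div_atTop γth,
      (eventually_gt_atTop 0).mono fun γbar h => div_pos hγth h⟩
  have hk : (0 : ℝ) < K := by exact_mod_cast hK
  have hlead : Tendsto (fun r : ℝ => r * -Real.log r) (𝓝[>] 0) (𝓝[>] 0) := by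
    refine tendsto_nhdsWithin_iff.2 ⟨?_, ?_⟩
    · simpa [mul_comm] using (tendsto_log_mul_rpow_nhdsGT_zero one_pos).neg
    · filter_upwards [self_mem_nhdsWithin, tendsto_neg_log_nhdsGT_zero.eventually_gt_atTop 0]
        with r h₁ h₂ using mul_pos h₁ h₂
  have hexact := isEquivalent_const_mul_rpow_neg_sub_one_add_one
    isEquivalent_one_sub_besselK1 hlead hk hθ (-1 / θ)
  have happrox := isEquivalent_const_mul_rpow_neg_sub_one_add_one
    (isEquivalent_mul_const_sub_log (1 - 2 * Real.eulerMascheroniConstant)) hlead hk hθ (-1 / θ)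
  have hne : ∀ᶠ r : ℝ in 𝓝[>] 0, (K * (r * -Real.log r) ^ (-θ)) ^ (-1 / θ) ≠ 0 := by
    filter_upwards [hlead.eventually self_mem_nhdsWithin] with r h
    exact (Real.rpow_pos_of_pos (mul_pos hk (Real.rpow_pos_of_pos h _)) _).ne'
  have h₁ := (isEquivalent_iff_tendsto_one hne).1 hexact
  have h₂ := (isEquivalent_iff_tendsto_one hne).1 happrox
  have hquot := h₁.div h₂ one_ne_zero
  rw [div_one] at hquot
  have hratio := hquot.congr' (f₂ := fun r : ℝ =>
    (K * ((1 - 2 * Real.sqrt r * besselK1 (2 * Real.sqrt r)) ^ (-θ) - 1) + 1) ^ (-1 / θ) /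
      (K * ((r * (1 - 2 * Real.eulerMascheroniConstant - Real.log r)) ^ (-θ) - 1) + 1) ^
        (-1 / θ)) ?_
  · exact hratio.comp hr
  filter_upwards [hne] with r h
  simp only [Pi.div_apply]
  exact div_div_div_cancel_right₀ h _ _
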